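/- (Equilibrium tail bounds.) Let V be in the class 𝒞. There exist constants c, C > 0 such that for all N ≥ 2 and all u > 0: (a) π_N(‖x‖_∞ ≥ u√N) ≤ C·N·e^{−c·min(u², √N·u)}, where ‖x‖_∞ = max_{0≤i≤N}|x_i|; and (b) π_N(max_{1≤i≤N} |η_i| ≥ u) ≤ N·e^{−cu}, where η_i = x_i − x_{i−1}. -/

import Mathlib

open MeasureTheory Filter Real

noncomputable section

/-- The class 𝒞 of potentials: convex, at most polynomial growth, non-affine
(the asymptotic slopes at `+∞` and `-∞`, taken in the extended reals, differ). -/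
structure InClassC (V : ℝ → ℝ) : Prop where
  convex : ConvexOn ℝ Set.univ V
  growth : ∃ C > (0 : ℝ), ∃ K : ℝ, 1 ≤ K ∧ ∀ x : ℝ, |V x| ≤ C * (1 + |x|) ^ K
  slopes : ∃ vm vp : EReal,
    Tendsto (fun x : ℝ => ((V x / x : ℝ) : EReal)) atBot (nhds vm) ∧
    Tendsto (fun x : ℝ => ((V x / x : ℝ) : EReal)) atTop (nhds vp) ∧
    vm < vp

/-- Configuration in `Ω_N` built from the `N-1` inner coordinates: coordinates
`1,…,N-1` are free, all others (in particular `0` and `N`) vanish. -/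
def conf (N : ℕ) (y : Fin (N - 1) → ℝ) : ℕ → ℝ := fun k =>
  if h : 1 ≤ k ∧ k ≤ N - 1 then y ⟨k - 1, by omega⟩ else 0

/-- The Hamiltonian `H(x) = Σ_{k=1}^N V(x_k - x_{k-1})`. -/
def Ham (V : ℝ → ℝ) (N : ℕ) (x : ℕ → ℝ) : ℝ :=
  ∑ k ∈ Finset.range N, V (x (k + 1) - x k)

/-- Normalisation constant `Z_N`. -/
def Zpart (V : ℝ → ℝ) (N : ℕ) : ℝ :=
  ∫ y : Fin (N - 1) → ℝ, Real.exp (-(Ham V N (conf N y)))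

/-- The Gibbs measure `π_N` on `Ω_N`, viewed as a measure on configurations `ℕ → ℝ`:
the inner coordinates have density `e^{-H}/Z_N` w.r.t. Lebesgue measure. -/
def piN (V : ℝ → ℝ) (N : ℕ) : Measure (ℕ → ℝ) :=
  Measure.map (conf N)
    (volume.withDensity fun y : Fin (N - 1) → ℝ =>
      ENNReal.ofReal (Real.exp (-(Ham V N (conf N y))) / Zpart V N))

theorem lintegral_snoc (n : ℕ) (F : (Fin (n+1) → ℝ) → ENNReal) (hF : Measurable F) :
    ∫⁻ y, F y = ∫⁻ y : Fin n → ℝ, ∫⁻ z : ℝ, F (Fin.snoc (α := fun _ => ℝ) y z) := by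
  have h := (volume_preserving_piFinSuccAbove (fun _ : Fin (n + 1) => ℝ) (Fin.last n)).symm
  rw [← h.lintegral_comp hF]
  have hm : Measurable (fun a : ℝ × (Fin n → ℝ) =>
      F ((MeasurableEquiv.piFinSuccAbove (fun _ : Fin (n+1) => ℝ) (Fin.last n)).symm a)) :=
    hF.comp (MeasurableEquiv.measurable _)
  rw [Measure.volume_eq_prod, lintegral_prod_symm _ hm.aemeasurable]
  simp [MeasurableEquiv.piFinSuccAbove_symm_apply]
  rfl

theorem conf_zero (N : ℕ) (y) : conf N y 0 = 0 := by simp [conf]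

theorem conf_last (N : ℕ) (hN : 1 ≤ N) (y) : conf N y N = 0 := by
  unfold conf
  rw [dif_neg]; omega

theorem conf_measurable (N : ℕ) : Measurable (conf N) := by
  refine measurable_pi_lambda _ fun k => ?_
  unfold conf
  by_cases h : 1 ≤ k ∧ k ≤ N - 1
  · simp only [h, and_self, dite_true]
    exact measurable_pi_apply _
  · simp only [h, dite_false]
    exact measurable_const

theorem conf_meas' (N k : ℕ) : Measurable (fun y => conf N y k) :=
  (measurable_pi_apply k).comp (conf_measurable N)

theorem conf_snoc_last (n : ℕ) (y : Fin (n+1) → ℝ) (z : ℝ) :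
    conf (n+3) (Fin.snoc (α := fun _ => ℝ) y z : Fin (n+2) → ℝ) (n+2) = z := by
  unfold conf
  rw [dif_pos (by omega)]
  have : (⟨n + 2 - 1, by omega⟩ : Fin (n+2)) = Fin.last (n+1) := by
    ext; simp
  change (Fin.snoc (α := fun _ => ℝ) y z : Fin (n+2) → ℝ) (⟨n + 2 - 1, by omega⟩ : Fin (n+2)) = z
  rw [this, Fin.snoc_last]

theorem conf_snoc (n : ℕ) (y : Fin (n+1) → ℝ) (z : ℝ) (k : ℕ) (hk : k ≤ n + 1) :
    conf (n+3) (Fin.snoc (α := fun _ => ℝ) y z : Fin (n+2) → ℝ) k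
      = conf (n+2) (y : Fin (n+1) → ℝ) k := by
  rcases Nat.eq_zero_or_pos k with rfl | h0
  · simp [conf]
  unfold conf
  rw [dif_pos (by omega), dif_pos (by omega)]
  have : (⟨k - 1, by omega⟩ : Fin (n+2)) = Fin.castSucc (⟨k-1, by omega⟩ : Fin (n+1)) := by
    ext; simp
  change (Fin.snoc (α := fun _ => ℝ) y z : Fin (n+2) → ℝ) (⟨k - 1, by omega⟩ : Fin (n+2)) = _
  rw [this, Fin.snoc_castSucc]

/-- Iterated convolution of the functions `f 0, …, f n`. -/
def Gc (f : ℕ → ℝ → ENNReal) : ℕ → ℝ → ENNReal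
  | 0 => f 0
  | n + 1 => fun w => ∫⁻ v, f (n+1) (w - v) * Gc f n v

theorem Gc_succ (f : ℕ → ℝ → ENNReal) (n : ℕ) (w : ℝ) :
    Gc f (n+1) w = ∫⁻ v, f (n+1) (w - v) * Gc f n v := rfl

theorem Gc_meas (f : ℕ → ℝ → ENNReal) (hf : ∀ i, Measurable (f i)) : ∀ n, Measurable (Gc f n)
  | 0 => hf 0
  | n + 1 => by
    have := Gc_meas f hf n
    have h2 := hf (n+1)
    unfold Gc
    apply Measurable.lintegral_prod_right'
      (f := fun q : ℝ × ℝ => f (n+1) (q.1 - q.2) * Gc f n q.2)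
    fun_prop

theorem Gc_int (f : ℕ → ℝ → ENNReal) (hf : ∀ i, Measurable (f i)) : ∀ n,
    ∫⁻ w, Gc f n w = ∏ i ∈ Finset.range (n+1), ∫⁻ x, f i x
  | 0 => by simp [Gc]
  | n + 1 => by
    have h1 := Gc_meas f hf n
    have h2 := hf (n+1)
    rw [Finset.prod_range_succ, ← Gc_int f hf n]
    simp_rw [Gc_succ]
    rw [lintegral_lintegral_swap (by fun_prop)]
    have : ∀ y, ∫⁻ x, f (n+1) (x - y) * Gc f n y = (∫⁻ x, f (n+1) x) * Gc f n y := by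
      intro y
      rw [lintegral_mul_const _ (by fun_prop), lintegral_sub_right_eq_self (fun x => f (n+1) x)]
    simp_rw [this]
    rw [lintegral_const_mul _ h1, mul_comm]

theorem lint_conf (f : ℕ → ℝ → ENNReal) (hf : ∀ i, Measurable (f i)) (n : ℕ) :
    ∀ F : ℝ → ENNReal, Measurable F →
    ∫⁻ y : Fin (n+1) → ℝ, (∏ i ∈ Finset.range (n+1),
        f i (conf (n+2) y (i+1) - conf (n+2) y i)) * F (conf (n+2) y (n+1))
      = ∫⁻ w, F w * Gc f n w := by
  have hprod : ∀ m : ℕ, Measurable (fun y : Fin (m+1) → ℝ => ∏ i ∈ Finset.range (m+1),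
        f i (conf (m+2) y (i+1) - conf (m+2) y i)) := by
    intro m
    refine Finset.measurable_prod _ fun i _ => ?_
    exact (hf i).comp ((conf_meas' (m+2) (i+1)).sub (conf_meas' (m+2) i))
  induction n with
  | zero =>
    intro F hF
    have h0 := hf 0
    have h1 : ∀ y : Fin 1 → ℝ, conf 2 y 1 = y 0 := by
      intro y; simp [conf]
    simp only [zero_add, Finset.prod_range_one, Gc, conf_zero, h1, sub_zero]
    have := (volume_preserving_funUnique (Fin 1) ℝ).lintegral_comp
      (f := fun x => f 0 x * F x) (by fun_prop)
    simp only [MeasurableEquiv.funUnique_apply] at this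
    simp only [mul_comm (F _)]
    exact this
  | succ n ih =>
    intro F hF
    have hm := hprod (n+1)
    have hm' := hprod n
    have hc := conf_meas' (n+3) (n+2)
    refine (lintegral_snoc _ _ (hm.mul (hF.comp hc))).trans ?_
    have key : ∀ (y : Fin (n+1) → ℝ) (z : ℝ),
      (∏ i ∈ Finset.range (n+1+1),
        f i (conf (n+1+2) (Fin.snoc (α := fun _ => ℝ) y z : Fin (n+2) → ℝ) (i+1)
          - conf (n+1+2) (Fin.snoc (α := fun _ => ℝ) y z : Fin (n+2) → ℝ) i))
        * F (conf (n+1+2) (Fin.snoc (α := fun _ => ℝ) y z : Fin (n+2) → ℝ) (n+1+1))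
      = (∏ i ∈ Finset.range (n+1),
        f i (conf (n+2) y (i+1) - conf (n+2) y i)) *
          (f (n+1) (z - conf (n+2) y (n+1)) * F z) := by
      intro y z
      rw [Finset.prod_range_succ]
      have e1 := conf_snoc_last n y z
      have e2 := conf_snoc n y z
      rw [e1, e2 (n+1) le_rfl, mul_assoc]
      congr 1
      refine Finset.prod_congr rfl fun i hi => ?_
      have := Finset.mem_range.1 hi
      rw [e2 i (by omega), e2 (i+1) (by omega)]
    have h2 := hf (n+1)
    have hG := Gc_meas f hf n
    calc _ = ∫⁻ y : Fin (n+1) → ℝ, (∏ i ∈ Finset.range (n+1),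
        f i (conf (n+2) y (i+1) - conf (n+2) y i)) *
          (fun v => ∫⁻ z, f (n+1) (z - v) * F z) (conf (n+2) y (n+1)) := by
          refine lintegral_congr fun y => ?_
          refine (lintegral_congr fun z => key y z).trans ?_
          rw [lintegral_const_mul _ (by fun_prop)]
      _ = ∫⁻ w, (∫⁻ z, f (n+1) (z - w) * F z) * Gc f n w := by
          refine ih (fun v => ∫⁻ z, f (n+1) (z - v) * F z) ?_
          apply Measurable.lintegral_prod_right'
            (f := fun q : ℝ × ℝ => f (n+1) (q.2 - q.1) * F q.2)
          fun_prop
      _ = ∫⁻ w, ∫⁻ z, f (n+1) (z - w) * F z * Gc f n w := by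
          refine lintegral_congr fun w => ?_
          rw [lintegral_mul_const _ (by fun_prop)]
      _ = ∫⁻ z, ∫⁻ w, f (n+1) (z - w) * F z * Gc f n w := by
          rw [lintegral_lintegral_swap (by fun_prop)]
      _ = _ := by
          refine lintegral_congr fun z => ?_
          rw [Gc_succ, ← lintegral_const_mul _ (by fun_prop)]
          refine lintegral_congr fun w => ?_
          ring

/-- The full product, with the last increment determined by the pinning. -/
theorem lint_conf_full (f : ℕ → ℝ → ENNReal) (hf : ∀ i, Measurable (f i)) (n : ℕ) :
    ∫⁻ y : Fin (n+1) → ℝ, (∏ i ∈ Finset.range (n+2),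
        f i (conf (n+2) y (i+1) - conf (n+2) y i)) = Gc f (n+1) 0 := by
  have h2 := hf (n+1)
  have := lint_conf f hf n (fun w => f (n+1) (0 - w)) (by fun_prop)
  rw [Gc_succ, ← this]
  refine lintegral_congr fun y => ?_
  rw [Finset.prod_range_succ, conf_last (n+2) (by omega) y]

theorem Gc_le (f : ℕ → ℝ → ENNReal) (hf : ∀ i, Measurable (f i)) (n : ℕ) (B : ENNReal)
    (hB : ∀ x, f (n+1) x ≤ B) (w : ℝ) :
    Gc f (n+1) w ≤ B * ∏ i ∈ Finset.range (n+1), ∫⁻ x, f i x := by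
  rw [← Gc_int f hf n, ← lintegral_const_mul _ (Gc_meas f hf n), Gc_succ]
  exact lintegral_mono fun v => mul_le_mul_left (hB _) _

theorem conv_incr {W : ℝ → ℝ} (hW : ConvexOn ℝ Set.univ W) {x x' δ : ℝ} (hx : x ≤ x')
    (hδ : 0 < δ) : W (x + δ) + W x' ≤ W x + W (x' + δ) := by
  have hl : 0 < x' - x + δ := by linarith
  have a1 : 0 ≤ (x'-x)/(x'-x+δ) := by apply div_nonneg <;> linarith
  have a2 : 0 ≤ δ/(x'-x+δ) := by positivity
  have a3 : (x'-x)/(x'-x+δ) + δ/(x'-x+δ) = 1 := by field_simp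
  have h1 := hW.2 (Set.mem_univ x) (Set.mem_univ (x'+δ)) a1 a2 a3
  have h2 := hW.2 (Set.mem_univ x) (Set.mem_univ (x'+δ)) a2 a1 (by linarith)
  simp only [smul_eq_mul] at h1 h2
  have e1 : (x'-x)/(x'-x+δ) * x + δ/(x'-x+δ) * (x'+δ) = x + δ := by
    field_simp
    try ring
  have e2 : δ/(x'-x+δ) * x + (x'-x)/(x'-x+δ) * (x'+δ) = x' := by
    field_simp
    try ring
  rw [e1] at h1
  rw [e2] at h2
  have e3 : (x'-x)/(x'-x+δ) + δ/(x'-x+δ) = 1 := by field_simp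
  have : W (x+δ) + W x' ≤ ((x'-x)/(x'-x+δ) + δ/(x'-x+δ)) * W x +
    ((x'-x)/(x'-x+δ) + δ/(x'-x+δ)) * W (x'+δ) := by linarith
  rw [e3] at this
  linarith

/-- Increments change sign at most once, from positive to nonpositive. -/
def Psgn (g : ℝ → ℝ) : Prop :=
  ∀ δ > 0, ∀ x x', x ≤ x' → g (x + δ) ≤ g x → g (x' + δ) ≤ g x'

theorem Psgn_exp {W : ℝ → ℝ} (hW : ConvexOn ℝ Set.univ W) : Psgn (fun x => exp (-W x)) := by
  intro δ hδ x x' hx h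
  have := conv_incr hW hx hδ
  simp only [exp_le_exp] at h ⊢
  linarith

theorem Psgn_conv {W : ℝ → ℝ} (hW : ConvexOn ℝ Set.univ W) {g : ℝ → ℝ} (B : ℝ)
    (hB : ∀ x, exp (-W x) ≤ B) (hg : Integrable g) (hc : Continuous W)
    (hP : Psgn g) : Psgn (fun w => ∫ v, exp (-W (w - v)) * g v) := by
  intro δ hδ x x' hx h
  have hint : ∀ (w : ℝ) (f : ℝ → ℝ), Integrable f →
      Integrable (fun v => exp (-W (w - v)) * f v) := by
    intro w f hf
    refine hf.bdd_mul (c := B) (by fun_prop) (Eventually.of_forall fun v => ?_)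
    rw [norm_of_nonneg (exp_pos _).le]
    exact hB _
  have hgs : Integrable (fun v => g (v + δ)) := hg.comp_add_right δ
  have hD : Integrable (fun v => g (v + δ) - g v) := hgs.sub hg
  have hT : ∀ w, (∫ v, exp (-W (w + δ - v)) * g v) - ∫ v, exp (-W (w - v)) * g v
      = ∫ v, exp (-W (w - v)) * (g (v + δ) - g v) := by
    intro w
    rw [← integral_add_right_eq_self (fun v => exp (-W (w + δ - v)) * g v) δ]
    have e : ∀ v, w + δ - (v + δ) = w - v := fun v => by ring
    simp only [e, mul_sub]
    rw [integral_sub (hint w _ hgs) (hint w _ hg)]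
  have h1 := hT x
  have h2 := hT x'
  suffices hs : ∫ v, exp (-W (x' - v)) * (g (v + δ) - g v) ≤ 0 by
    simp only
    linarith
  have h0 : ∫ v, exp (-W (x - v)) * (g (v + δ) - g v) ≤ 0 := by
    simp only at h
    linarith
  by_cases hA : ∃ y, g (y + δ) ≤ g y
  · by_cases hB' : ∃ y, g y < g (y + δ)
    · obtain ⟨a, ha⟩ := hA
      obtain ⟨b, hb⟩ := hB'
      set S : Set ℝ := {y | g (y + δ) ≤ g y} with hS
      have hbd : BddBelow S := by
        refine ⟨b, fun y hy => ?_⟩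
        by_contra hcon
        have := hP δ hδ y b (le_of_lt (not_le.1 hcon)) hy
        linarith
      have hne : S.Nonempty := ⟨a, ha⟩
      set y0 := sInf S
      set ρ := exp (-W (x' - y0)) / exp (-W (x - y0)) with hρ
      have hlow : ∀ v, v < y0 → g v < g (v + δ) := by
        intro v hv
        by_contra hcon
        exact absurd (csInf_le hbd (show v ∈ S from not_lt.1 hcon)) (not_le.2 hv)
      have hhigh : ∀ v, y0 < v → g (v + δ) ≤ g v := by
        intro v hv
        obtain ⟨s, hs, hsv⟩ := exists_lt_of_csInf_lt hne hv
        exact hP δ hδ s v hsv.le hs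
      have hr : ∀ v v', v ≤ v' → exp (-W (x' - v)) * exp (-W (x - v'))
          ≤ exp (-W (x' - v')) * exp (-W (x - v)) := by
        intro v v' hv
        rw [← exp_add, ← exp_add, exp_le_exp]
        rcases hx.eq_or_lt with rfl | hlt
        · linarith
        have := conv_incr hW (x := x - v') (x' := x - v) (δ := x' - x) (by linarith) (by linarith)
        have e1 : x - v' + (x' - x) = x' - v' := by ring
        have e2 : x - v + (x' - x) = x' - v := by ring
        rw [e1, e2] at this
        linarith
      have hρ0 : 0 < ρ := by positivity
      have hpt : ∀ v, exp (-W (x' - v)) * (g (v + δ) - g v) ≤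
          ρ * (exp (-W (x - v)) * (g (v + δ) - g v)) := by
        intro v
        rcases lt_trichotomy v y0 with hv | hv | hv
        · have h3 := hlow v hv
          rw [← mul_assoc]
          refine mul_le_mul_of_nonneg_right ?_ (by linarith)
          rw [hρ, div_mul_eq_mul_div, le_div_iff₀ (exp_pos _)]
          exact hr v y0 hv.le
        · rw [hv, hρ, ← mul_assoc, div_mul_cancel₀ _ (exp_pos _).ne']
        · have h3 := hhigh v hv
          rw [← mul_assoc]
          refine mul_le_mul_of_nonpos_right ?_ (by linarith)
          rw [hρ, div_mul_eq_mul_div, div_le_iff₀ (exp_pos _)]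
          exact hr y0 v hv.le
      calc _ ≤ ∫ v, ρ * (exp (-W (x - v)) * (g (v + δ) - g v)) :=
            integral_mono (hint _ _ hD) ((hint _ _ hD).const_mul ρ) hpt
        _ = ρ * ∫ v, (exp (-W (x - v)) * (g (v + δ) - g v)) := integral_const_mul _ _
        _ ≤ 0 := mul_nonpos_of_nonneg_of_nonpos hρ0.le h0
    · push Not at hB'
      refine integral_nonpos fun v => ?_
      exact mul_nonpos_of_nonneg_of_nonpos (exp_pos _).le (by have := hB' v; linarith)
  · push Not at hA
    exfalso
    have hpos : ∀ v, 0 < exp (-W (x - v)) * (g (v + δ) - g v) := fun v =>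
      mul_pos (exp_pos _) (by have := hA v; linarith)
    have : 0 < ∫ v, exp (-W (x - v)) * (g (v + δ) - g v) := by
      rw [integral_pos_iff_support_of_nonneg (fun v => (hpos v).le) (hint _ _ hD)]
      have : Function.support (fun v => exp (-W (x - v)) * (g (v + δ) - g v)) = Set.univ := by
        ext v; simpa using (hpos v).ne'
      rw [this]; simp
    linarith

theorem Psgn_side {g : ℝ → ℝ} (hc : Continuous g) (hP : Psgn g) :
    (∀ z, 0 < z → g z ≤ g 0) ∨ (∀ z, z < 0 → g z ≤ g 0) := by
  by_contra hcon
  push Not at hcon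
  obtain ⟨⟨a, ha, hga⟩, b, hb, hgb⟩ := hcon
  obtain ⟨η, hη, hball⟩ := Metric.isOpen_iff.1 (isOpen_lt continuous_const hc) a hga
  obtain ⟨n, hn⟩ := exists_nat_gt (-b / η)
  have hbη : 0 < -b / η := by apply div_pos <;> linarith
  have hn0 : (0:ℝ) < n := hbη.trans hn
  set δ := -b / n with hδ
  have hδ0 : 0 < δ := by apply div_pos <;> linarith
  have hδη : δ < η := by
    rw [hδ, div_lt_iff₀ hn0]
    rw [div_lt_iff₀ hη] at hn
    linarith
  have hex : ∃ j : ℕ, j < n ∧ g (b + j * δ + δ) ≤ g (b + j * δ) := by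
    by_contra hcon
    push Not at hcon
    have : ∀ j : ℕ, j ≤ n → g b ≤ g (b + j * δ) := by
      intro j
      induction j with
      | zero => intro _; simp
      | succ j ih =>
        intro hj
        have h1 := ih (by omega)
        have h2 := hcon j (by omega)
        have e : b + ((j+1 : ℕ) : ℝ) * δ = b + j * δ + δ := by push_cast; ring
        rw [e]
        linarith
    have h3 := this n le_rfl
    have e : b + n * δ = 0 := by rw [hδ]; field_simp; ring
    rw [e] at h3
    linarith
  obtain ⟨j, hj, hgj⟩ := hex
  have hle0 : b + j * δ ≤ 0 := by
    have e : b + n * δ = 0 := by rw [hδ]; field_simp; ring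
    have : (j:ℝ) * δ ≤ n * δ := by
      have : (j:ℝ) ≤ n := by exact_mod_cast hj.le
      gcongr
    linarith
  have hk : ∀ k : ℕ, g (k * δ) ≤ g 0 := by
    intro k
    induction k with
    | zero => simp
    | succ k ih =>
      have h0 : (0:ℝ) ≤ k * δ := by positivity
      have := hP δ hδ0 _ (k * δ) (hle0.trans h0) hgj
      have e : ((k+1 : ℕ) : ℝ) * δ = k * δ + δ := by push_cast; ring
      rw [e]
      linarith
  have hfl := Nat.floor_le (a := a / δ) (by positivity)
  have hfl2 := Nat.lt_floor_add_one (a / δ)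
  rw [le_div_iff₀ hδ0] at hfl
  rw [div_lt_iff₀ hδ0] at hfl2
  have hmem : (⌊a/δ⌋₊ : ℝ) * δ ∈ Metric.ball a η := by
    rw [Metric.mem_ball, Real.dist_eq, abs_lt]
    constructor <;> linarith
  have h5 : g 0 < g ((⌊a/δ⌋₊ : ℝ) * δ) := hball hmem
  have := hk ⌊a/δ⌋₊
  linarith

/-- Normalised and centred log-concave density `e^{-W}` with exponential decay. -/
structure Nice (W : ℝ → ℝ) (ε B : ℝ) : Prop where
  cv : ConvexOn ℝ Set.univ W
  one : ∫⁻ x, ENNReal.ofReal (exp (-W x)) = 1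
  ge : ∀ s : ℝ, 1 ≤ ∫⁻ x, ENNReal.ofReal (exp (s * x - W x))
  eps : 0 < ε
  bpos : 0 < B
  dec : ∀ x, exp (-W x) ≤ B * exp (-(ε * |x|))

theorem cont_of_cv {W : ℝ → ℝ} (h : ConvexOn ℝ Set.univ W) : Continuous W :=
  h.locallyLipschitz.continuous

theorem integrable_exp_abs {c : ℝ} (hc : 0 < c) : Integrable (fun x : ℝ => exp (-(c * |x|))) := by
  rw [← integrableOn_univ, ← Set.Iic_union_Ioi (a := (0:ℝ))]
  refine IntegrableOn.union ?_ ?_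
  · refine (integrableOn_exp_mul_Iic hc 0).congr_fun (fun x hx => ?_) measurableSet_Iic
    simp only [abs_of_nonpos (Set.mem_Iic.1 hx)]
    ring_nf
  · refine (integrableOn_exp_mul_Ioi (a := -c) (by linarith) 0).congr_fun (fun x hx => ?_)
      measurableSet_Ioi
    simp only [abs_of_pos (Set.mem_Ioi.1 hx)]
    ring_nf

theorem Nice.le {W : ℝ → ℝ} {ε B : ℝ} (h : Nice W ε B) (x : ℝ) : exp (-W x) ≤ B := by
  refine (h.dec x).trans ?_
  have : exp (-(ε * |x|)) ≤ 1 := by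
    rw [exp_le_one_iff]
    have := mul_nonneg h.eps.le (abs_nonneg x)
    linarith
  nlinarith [h.bpos]

theorem exp_sym_le (t : ℝ) : exp t + exp (-t) ≤ 2 + t ^ 2 * exp |t| := by
  wlog ht : 0 ≤ t with H
  · have := H (-t) (by linarith)
    rw [abs_neg, neg_neg] at this
    nlinarith
  rw [abs_of_nonneg ht]
  have h1 : 1 - t ≤ exp (-t) := by have := add_one_le_exp (-t); linarith
  have h2 : exp (-t) ≤ 1 := by rw [exp_le_one_iff]; linarith
  have h3 : exp t * exp (-t) = 1 := by rw [← exp_add]; simp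
  have h4 : exp t + exp (-t) - 2 = exp t * (1 - exp (-t))^2 := by
    have : exp t * (1 - exp (-t))^2 = exp t - 2 * (exp t * exp (-t)) + (exp t * exp (-t)) * exp (-t) := by ring
    rw [this, h3]; ring
  have h5 : (1 - exp (-t))^2 ≤ t^2 := by
    apply pow_le_pow_left₀ <;> linarith
  have := mul_le_mul_of_nonneg_left h5 (exp_pos t).le
  linarith

theorem Nice.mgf {W : ℝ → ℝ} {ε B : ℝ} (h : Nice W ε B) :
    ∃ K > 0, ∀ s : ℝ, |s| ≤ ε / 4 →
      ∫⁻ x, ENNReal.ofReal (exp (s * x - W x)) ≤ ENNReal.ofReal (1 + K * s ^ 2) := by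
  have hc := cont_of_cv h.cv
  have hε := h.eps
  have hint : Integrable (fun x : ℝ => x^2 * exp (ε/4 * |x|) * exp (-W x)) := by
    refine ((integrable_exp_abs (c := ε/2) (by linarith)).const_mul (B * (32 / ε^2))).mono'
      (by fun_prop) (Eventually.of_forall fun x => ?_)
    rw [norm_of_nonneg (by positivity)]
    have h1 := quadratic_le_exp_of_nonneg (x := ε/4 * |x|) (by positivity)
    have h2 : x^2 ≤ 32/ε^2 * exp (ε/4*|x|) := by
      have : (ε/4*|x|)^2 / 2 ≤ exp (ε/4*|x|) := by
        have : 0 ≤ ε/4*|x| := by positivity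
        linarith
      rw [mul_pow, sq_abs] at this
      rw [div_mul_eq_mul_div, le_div_iff₀ (by positivity)]
      nlinarith
    calc _ ≤ (32/ε^2 * exp (ε/4*|x|)) * exp (ε/4 * |x|) * (B * exp (-(ε * |x|))) := by
          gcongr
          exact h.dec x
      _ = B * (32 / ε^2) * (exp (ε/4*|x|) * exp (ε/4 * |x|) * exp (-(ε * |x|))) := by ring
      _ = _ := by
          rw [← exp_add, ← exp_add]; congr 2; ring
  set K := ∫ x, x^2 * exp (ε/4 * |x|) * exp (-W x) with hK
  have hK0 : 0 ≤ K := integral_nonneg fun x => by positivity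
  refine ⟨K + 1, by linarith, fun s hs => ?_⟩
  have hsum : (∫⁻ x, ENNReal.ofReal (exp (s * x - W x))) +
      (∫⁻ x, ENNReal.ofReal (exp ((-s) * x - W x))) ≤ 1 + ENNReal.ofReal (1 + K * s^2) := by
    rw [← lintegral_add_left (by fun_prop)]
    calc _ ≤ ∫⁻ x, (2 * ENNReal.ofReal (exp (-W x)) +
          ENNReal.ofReal (s^2) * ENNReal.ofReal (x^2 * exp (ε/4 * |x|) * exp (-W x))) := by
          refine lintegral_mono fun x => ?_
          rw [← ENNReal.ofReal_add (exp_pos _).le (exp_pos _).le,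
            ← ENNReal.ofReal_mul (by positivity),
            show (2:ENNReal) = ENNReal.ofReal 2 by simp, ← ENNReal.ofReal_mul (by positivity),
            ← ENNReal.ofReal_add (by positivity) (by positivity)]
          apply ENNReal.ofReal_le_ofReal
          have h1 := exp_sym_le (s * x)
          have h2 : exp |s*x| ≤ exp (ε/4 * |x|) := by
            rw [exp_le_exp, abs_mul]
            gcongr
          have e1 : exp (s * x - W x) = exp (s*x) * exp (-W x) := by rw [← exp_add]; ring_nf
          have e2 : exp (-s * x - W x) = exp (-(s*x)) * exp (-W x) := by rw [← exp_add]; ring_nf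
          rw [e1, e2]
          have h3 : exp (s*x) + exp (-(s*x)) ≤ 2 + (s*x)^2 * exp (ε/4 * |x|) := by
            refine h1.trans ?_
            gcongr
          have := mul_le_mul_of_nonneg_right h3 (exp_pos (-W x)).le
          linarith
      _ = 2 * 1 + ENNReal.ofReal (s^2) * ENNReal.ofReal K := by
          rw [lintegral_add_left (by fun_prop), lintegral_const_mul _ (by fun_prop),
            lintegral_const_mul _ (by fun_prop), h.one, hK,
            ofReal_integral_eq_lintegral_ofReal hint (Eventually.of_forall fun x => by positivity)]
      _ = _ := by
          rw [← ENNReal.ofReal_mul (by positivity), ENNReal.ofReal_add (by norm_num) (by positivity),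
            ENNReal.ofReal_one, ← add_assoc, mul_comm K]
          norm_num
  have hge := h.ge (-s)
  have h6 : 1 + (∫⁻ x, ENNReal.ofReal (exp (s * x - W x))) ≤ 1 + ENNReal.ofReal (1 + K * s^2) := by
    refine le_trans ?_ hsum
    rw [add_comm]
    gcongr
  have h7 := (ENNReal.add_le_add_iff_left ENNReal.one_ne_top).1 h6
  refine h7.trans (ENNReal.ofReal_le_ofReal ?_)
  nlinarith [sq_nonneg s]

theorem Gc_tilt (W : ℝ → ℝ) (hc : Continuous W) (s : ℝ) : ∀ (n : ℕ) (w : ℝ),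
    ENNReal.ofReal (exp (s * w)) * Gc (fun _ x => ENNReal.ofReal (exp (-W x))) n w
      = Gc (fun _ x => ENNReal.ofReal (exp (s * x - W x))) n w
  | 0, w => by
    simp only [Gc]
    rw [← ENNReal.ofReal_mul (exp_pos _).le, ← exp_add]
    rfl
  | n + 1, w => by
    have hm : Measurable (Gc (fun _ x => ENNReal.ofReal (exp (-W x))) n) :=
      Gc_meas _ (fun i => by fun_prop) n
    rw [Gc_succ, Gc_succ, ← lintegral_const_mul _ (by fun_prop)]
    refine lintegral_congr fun v => ?_
    rw [← Gc_tilt W hc s n v, ← mul_assoc, ← mul_assoc, ← ENNReal.ofReal_mul (exp_pos _).le,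
      ← ENNReal.ofReal_mul (exp_pos _).le, ← exp_add, ← exp_add]
    congr 3
    ring

/-- Real-valued iterated convolution. -/
def hC (p : ℝ → ℝ) : ℕ → ℝ → ℝ
  | 0 => p
  | n + 1 => fun w => ∫ v, p (w - v) * hC p n v

theorem Nice.Gc_total {W : ℝ → ℝ} {ε B : ℝ} (h : Nice W ε B) (n : ℕ) :
    ∫⁻ w, Gc (fun _ x => ENNReal.ofReal (exp (-W x))) n w = 1 := by
  have hc := cont_of_cv h.cv
  rw [Gc_int _ (fun i => by fun_prop)]
  simp [h.one]

theorem Nice.Gc_bd {W : ℝ → ℝ} {ε B : ℝ} (h : Nice W ε B) (n : ℕ) (w : ℝ) :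
    Gc (fun _ x => ENNReal.ofReal (exp (-W x))) n w ≤ ENNReal.ofReal B := by
  have hc := cont_of_cv h.cv
  cases n with
  | zero => exact ENNReal.ofReal_le_ofReal (h.le w)
  | succ n =>
    refine (Gc_le _ (fun i => by fun_prop) n (ENNReal.ofReal B)
      (fun x => ENNReal.ofReal_le_ofReal (h.le x)) w).trans ?_
    simp [h.one]

theorem Nice.hC_props {W : ℝ → ℝ} {ε B : ℝ} (h : Nice W ε B) (n : ℕ) :
    Continuous (hC (fun x => exp (-W x)) n) ∧ (∀ w, 0 ≤ hC (fun x => exp (-W x)) n w) ∧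
    (∀ w, ENNReal.ofReal (hC (fun x => exp (-W x)) n w)
      = Gc (fun _ x => ENNReal.ofReal (exp (-W x))) n w) ∧
    Psgn (hC (fun x => exp (-W x)) n) := by
  have hc := cont_of_cv h.cv
  induction n with
  | zero =>
    exact ⟨by unfold hC; fun_prop, fun w => (exp_pos _).le, fun w => rfl, Psgn_exp h.cv⟩
  | succ n ih =>
    obtain ⟨i1, i2, i3, i4⟩ := ih
    have hI : Integrable (hC (fun x => exp (-W x)) n) := by
      refine ⟨i1.aestronglyMeasurable, ?_⟩
      rw [hasFiniteIntegral_iff_ofReal (Eventually.of_forall i2)]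
      simp_rw [i3]
      rw [h.Gc_total]
      simp
    have hint : ∀ w, Integrable (fun v => exp (-W (w - v)) * hC (fun x => exp (-W x)) n v) := by
      intro w
      refine hI.bdd_mul (c := B) (by fun_prop) (Eventually.of_forall fun v => ?_)
      rw [norm_of_nonneg (exp_pos _).le]
      exact h.le _
    refine ⟨?_, ?_, ?_, ?_⟩
    · change Continuous (fun w => ∫ v, exp (-W (w - v)) * hC (fun x => exp (-W x)) n v)
      refine continuous_of_dominated (bound := fun v => B * hC (fun x => exp (-W x)) n v)
        (fun w => (hint w).aestronglyMeasurable) (fun w => Eventually.of_forall fun v => ?_)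
        (hI.const_mul B) (Eventually.of_forall fun v => by fun_prop)
      rw [norm_of_nonneg (mul_nonneg (exp_pos _).le (i2 v))]
      exact mul_le_mul_of_nonneg_right (h.le _) (i2 v)
    · intro w
      exact integral_nonneg fun v => mul_nonneg (exp_pos _).le (i2 v)
    · intro w
      rw [Gc_succ]
      change ENNReal.ofReal (∫ v, exp (-W (w - v)) * hC (fun x => exp (-W x)) n v) = _
      rw [ofReal_integral_eq_lintegral_ofReal (hint w)
        (Eventually.of_forall fun v => mul_nonneg (exp_pos _).le (i2 v))]
      refine lintegral_congr fun v => ?_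
      rw [ENNReal.ofReal_mul (exp_pos _).le, i3]
    · exact Psgn_conv h.cv B h.le hI hc i4

theorem low_abs (g : ℝ → ENNReal) (hm : Measurable g) {B τ s L E r : ℝ} (hB : 0 ≤ B) (hτ : 0 ≤ τ)
    (hs : 0 < s) (hL : 0 ≤ L) (hE : 0 ≤ E) (hr : 0 ≤ r)
    (h1 : ∫⁻ z, g z = 1) (hgB : ∀ z, g z ≤ ENNReal.ofReal B)
    (hgτ : ∀ z, 0 < z → g z ≤ ENNReal.ofReal τ)
    (hge : 1 ≤ ∫⁻ z, ENNReal.ofReal (exp (s * z)) * g z)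
    (hle : ∫⁻ z, ENNReal.ofReal (exp (2 * s * z)) * g z ≤ ENNReal.ofReal E) :
    1 ≤ exp (-(s * r)) + (1 - exp (-(s * r))) * (B * r) + τ * L * exp (s * L)
      + E * exp (-(s * L)) := by
  have hsr : exp (-(s*r)) ≤ 1 := by
    rw [exp_le_one_iff]
    have := mul_nonneg hs.le hr
    linarith
  have hpt : ∀ z, ENNReal.ofReal (exp (s * z)) * g z ≤
      ENNReal.ofReal (exp (-(s*r))) * g z
      + (Set.Ioc (-r) 0).indicator (fun _ => ENNReal.ofReal ((1 - exp (-(s*r))) * B)) z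
      + (Set.Ioc 0 L).indicator (fun _ => ENNReal.ofReal (exp (s*L) * τ)) z
      + ENNReal.ofReal (exp (-(s*L))) * (ENNReal.ofReal (exp (2 * s * z)) * g z) := by
    intro z
    rcases le_or_gt z (-r) with hz | hz
    · refine le_trans ?_ (le_trans le_self_add (le_trans le_self_add le_self_add))
      gcongr
      nlinarith
    rcases le_or_gt z 0 with hz0 | hz0
    · refine le_trans ?_ (le_trans le_self_add le_self_add)
      rw [Set.indicator_of_mem (show z ∈ Set.Ioc (-r) 0 from ⟨hz, hz0⟩)]
      calc _ ≤ ENNReal.ofReal (exp (-(s*r)) + (1 - exp (-(s*r)))) * g z := by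
            gcongr
            rw [add_sub_cancel, exp_le_one_iff]
            nlinarith
        _ = ENNReal.ofReal (exp (-(s*r))) * g z + ENNReal.ofReal (1 - exp (-(s*r))) * g z := by
            rw [ENNReal.ofReal_add (exp_pos _).le (by linarith), add_mul]
        _ ≤ _ := by
            rw [ENNReal.ofReal_mul (by linarith)]
            gcongr
            exact hgB z
    rcases le_or_gt z L with hzL | hzL
    · refine le_trans ?_ le_self_add
      refine le_trans ?_ le_add_self
      rw [Set.indicator_of_mem (show z ∈ Set.Ioc 0 L from ⟨hz0, hzL⟩), ENNReal.ofReal_mul (exp_pos _).le]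
      gcongr
      exact hgτ z hz0
    · refine le_trans ?_ le_add_self
      rw [← mul_assoc, ← ENNReal.ofReal_mul (exp_pos _).le, ← exp_add]
      gcongr
      nlinarith
  have hfin := hge.trans (lintegral_mono hpt)
  rw [lintegral_add_left (by
      refine Measurable.add (Measurable.add (by fun_prop) ?_) ?_
      · exact measurable_const.indicator measurableSet_Ioc
      · exact measurable_const.indicator measurableSet_Ioc),
    lintegral_add_right _ (measurable_const.indicator measurableSet_Ioc),
    lintegral_add_right _ (measurable_const.indicator measurableSet_Ioc),
    lintegral_const_mul _ hm, lintegral_const_mul _ (by fun_prop),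
    lintegral_indicator_const measurableSet_Ioc, lintegral_indicator_const measurableSet_Ioc, h1,
    Real.volume_Ioc, Real.volume_Ioc, mul_one] at hfin
  have hfin2 : (1:ENNReal) ≤ ENNReal.ofReal (exp (-(s * r)) + (1 - exp (-(s * r))) * (B * r)
      + τ * L * exp (s * L) + E * exp (-(s * L))) := by
    refine hfin.trans ?_
    have hb : 0 ≤ (1 - exp (-(s*r))) * B := mul_nonneg (by linarith) hB
    rw [ENNReal.ofReal_add _ (by positivity), ENNReal.ofReal_add _ (by positivity),
      ENNReal.ofReal_add (by positivity)]
    · rw [← ENNReal.ofReal_mul hb, ← ENNReal.ofReal_mul (by positivity)]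
      refine add_le_add (add_le_add (add_le_add le_rfl (le_of_eq ?_)) (le_of_eq ?_)) ?_
      · congr 1; ring
      · congr 1; ring
      · rw [mul_comm E, ENNReal.ofReal_mul (exp_pos _).le]
        gcongr
    · rw [← mul_assoc]; positivity
    · rw [← mul_assoc]; positivity
    · rw [← mul_assoc]; positivity
  exact ENNReal.one_le_ofReal.1 hfin2

theorem low_num {B τ s E : ℝ} (hB : 0 < B) (hτ : 0 ≤ τ) (hs : 0 < s) (hE : 1 ≤ E)
    (hsB : s ≤ 2 * B)
    (H : ∀ L, 0 ≤ L → 1 ≤ exp (-(s * (1/(2*B)))) + (1 - exp (-(s * (1/(2*B))))) * (B * (1/(2*B)))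
      + τ * L * exp (s * L) + E * exp (-(s * L))) :
    s ^ 4 * (1/(2*B)) ^ 3 / (512 * E^2) ≤ τ := by
  set r := 1/(2*B) with hr
  have hr0 : 0 < r := by positivity
  have hBr : B * r = 1/2 := by rw [hr]; field_simp
  have hsr : s * r ≤ 1 := by
    rw [hr, mul_one_div, div_le_one (by positivity)]; exact hsB
  have hx : 0 < s * r := by positivity
  set A := 8 * E / (s * r) with hA
  have hA1 : 1 ≤ A := by rw [hA, le_div_iff₀ hx]; linarith
  have hA0 : 0 < A := by linarith
  have hL0 : 0 ≤ log A / s := div_nonneg (log_nonneg hA1) hs.le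
  have h := H (log A / s) hL0
  have e1 : s * (log A / s) = log A := by field_simp
  rw [hBr, e1, exp_log hA0, exp_neg (log A), exp_log hA0] at h
  have h2 : exp (-(s*r)) ≤ 1 - s * r / 2 := by
    rw [exp_neg]
    rw [inv_le_comm₀ (exp_pos _) (by linarith)]
    refine le_trans ?_ (add_one_le_exp (s*r))
    rw [inv_le_iff_one_le_mul₀ (by linarith)]
    nlinarith
  have h3 : E * A⁻¹ = s * r / 8 := by rw [hA]; field_simp
  rw [h3] at h
  have h4 : s * r / 8 ≤ τ * (log A / s) * A := by linarith
  have h5 : log A ≤ A := (log_le_sub_one_of_pos hA0).trans (by linarith)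
  have h6 : s * r / 8 ≤ τ * (A / s) * A := by
    refine h4.trans ?_
    gcongr
  have h7 : τ * (A / s) * A = τ * (64 * E^2) / (s^3 * r^2) := by
    rw [hA]; field_simp; ring
  rw [h7, le_div_iff₀ (by positivity)] at h6
  rw [div_le_iff₀ (by positivity)]
  nlinarith

theorem Nice.low {W : ℝ → ℝ} {ε B : ℝ} (h : Nice W ε B) :
    ∃ D > 0, ∀ n : ℕ, D / ((n:ℝ) + 2) ^ 2 ≤ hC (fun x => exp (-W x)) (n+1) 0 := by
  obtain ⟨K, hK, hmgf⟩ := h.mgf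
  have hc := cont_of_cv h.cv
  have hε := h.eps
  have hB := h.bpos
  set κ := min (ε/8) (2*B) with hκ
  have hκ0 : 0 < κ := by rw [hκ]; positivity
  set E := exp (4 * K * κ^2) with hE
  have hE1 : 1 ≤ E := by rw [hE, one_le_exp_iff]; positivity
  refine ⟨κ ^ 4 * (1/(2*B)) ^ 3 / (512 * E^2), by positivity, fun n => ?_⟩
  set N : ℝ := (n:ℝ) + 2 with hN
  have hN1 : 1 ≤ N := by rw [hN]; have : (0:ℝ) ≤ n := by positivity
                         linarith
  have hN0 : 0 < N := by linarith
  set s := κ / sqrt N with hs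
  have hsq1 : 1 ≤ sqrt N := by rw [one_le_sqrt]; exact hN1
  have hs0 : 0 < s := by positivity
  have hsκ : s ≤ κ := div_le_self hκ0.le hsq1
  have hs2 : s^2 = κ^2 / N := by rw [hs, div_pow, sq_sqrt hN0.le]
  have hs4 : s^4 = κ^4 / N^2 := by
    have : s^4 = (s^2)^2 := by ring
    rw [this, hs2, div_pow]; ring
  obtain ⟨p1, p2, p3, p4⟩ := h.hC_props (n+1)
  have hGm : Measurable (Gc (fun _ x => ENNReal.ofReal (exp (-W x))) (n+1)) :=
    Gc_meas _ (fun i => by fun_prop) _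
  have htilt : ∀ t : ℝ, ∫⁻ z, ENNReal.ofReal (exp (t * z)) *
      Gc (fun _ x => ENNReal.ofReal (exp (-W x))) (n+1) z
      = (∫⁻ x, ENNReal.ofReal (exp (t * x - W x))) ^ (n+2) := by
    intro t
    simp_rw [Gc_tilt W hc t]
    rw [Gc_int _ (fun i => by fun_prop)]
    simp
  have hgeN : ∀ t : ℝ, 1 ≤ ∫⁻ z, ENNReal.ofReal (exp (t * z)) *
      Gc (fun _ x => ENNReal.ofReal (exp (-W x))) (n+1) z := by
    intro t
    rw [htilt]
    exact one_le_pow₀ (h.ge t)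
  have hleN : ∀ t : ℝ, |t| = 2 * s → ∫⁻ z, ENNReal.ofReal (exp (t * z)) *
      Gc (fun _ x => ENNReal.ofReal (exp (-W x))) (n+1) z ≤ ENNReal.ofReal E := by
    intro t ht
    rw [htilt]
    have h8 : κ ≤ ε/8 := min_le_left _ _
    have h1 := hmgf t (by rw [ht]; linarith)
    have ht2 : t^2 = 4 * s^2 := by rw [← sq_abs, ht]; ring
    calc _ ≤ (ENNReal.ofReal (1 + K * t^2)) ^ (n+2) := by gcongr
      _ ≤ (ENNReal.ofReal (exp (K * t^2))) ^ (n+2) := by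
          gcongr
          have := add_one_le_exp (K * t^2)
          linarith
      _ = ENNReal.ofReal E := by
          rw [← ENNReal.ofReal_pow (exp_pos _).le, ← exp_nat_mul, hE, ht2, hs2]
          congr 2
          push_cast
          rw [← hN]
          field_simp
  have hfin : s ^ 4 * (1/(2*B)) ^ 3 / (512 * E^2) ≤ hC (fun x => exp (-W x)) (n+1) 0 := by
    refine low_num hB (p2 0) hs0 hE1 (hsκ.trans (min_le_right _ _)) fun L hL => ?_
    rcases Psgn_side p1 p4 with hside | hside
    · refine low_abs (Gc (fun _ x => ENNReal.ofReal (exp (-W x))) (n+1)) hGm hB.le (p2 0) hs0 hL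
        (by positivity) (by positivity) (h.Gc_total _) (h.Gc_bd _) ?_ (hgeN s)
        (hleN (2*s) (abs_of_pos (by positivity)))
      intro z hz
      rw [← p3]
      exact ENNReal.ofReal_le_ofReal (hside z hz)
    · have hneg : ∀ t : ℝ, ∫⁻ z, ENNReal.ofReal (exp (t * z)) *
          Gc (fun _ x => ENNReal.ofReal (exp (-W x))) (n+1) (-z) =
          ∫⁻ z, ENNReal.ofReal (exp (-t * z)) *
          Gc (fun _ x => ENNReal.ofReal (exp (-W x))) (n+1) z := by
        intro t
        rw [← lintegral_neg_eq_self (fun z => ENNReal.ofReal (exp (-t * z)) *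
          Gc (fun _ x => ENNReal.ofReal (exp (-W x))) (n+1) z)]
        refine lintegral_congr fun z => ?_
        rw [neg_mul_neg]
      refine low_abs (fun z => Gc (fun _ x => ENNReal.ofReal (exp (-W x))) (n+1) (-z))
        (by fun_prop) hB.le (p2 0) hs0 hL
        (by positivity) (by positivity) ?_ (fun z => h.Gc_bd _ _) ?_ ?_ ?_
      · rw [lintegral_neg_eq_self (Gc (fun _ x => ENNReal.ofReal (exp (-W x))) (n+1))]
        exact h.Gc_total _
      · intro z hz
        rw [← p3]
        exact ENNReal.ofReal_le_ofReal (hside _ (by linarith))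
      · rw [hneg]; exact hgeN _
      · rw [hneg]; exact hleN _ (by rw [abs_neg]; exact abs_of_pos (by positivity))
  refine le_trans (le_of_eq ?_) hfin
  rw [hs4]
  field_simp

theorem Ham_meas {W : ℝ → ℝ} (hc : Continuous W) (N : ℕ) :
    Measurable (fun y => Ham W N (conf N y)) := by
  unfold Ham
  refine Finset.measurable_sum _ fun i _ => ?_
  exact hc.measurable.comp ((conf_meas' N (i+1)).sub (conf_meas' N i))

theorem exp_prod (W : ℝ → ℝ) (φ : ℕ → ℝ → ℝ) (N : ℕ) (x : ℕ → ℝ) :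
    ∏ i ∈ Finset.range N, ENNReal.ofReal (exp (φ i (x (i+1) - x i) - W (x (i+1) - x i)))
     = ENNReal.ofReal (exp ((∑ i ∈ Finset.range N, φ i (x (i+1) - x i)) - Ham W N x)) := by
  rw [← ENNReal.ofReal_prod_of_nonneg (fun i _ => (exp_pos _).le), ← exp_sum,
    Finset.sum_sub_distrib]
  rfl

theorem Nice.Zl {W : ℝ → ℝ} {ε B : ℝ} (h : Nice W ε B) (n : ℕ) :
    ∫⁻ y : Fin (n+1) → ℝ, ENNReal.ofReal (exp (-(Ham W (n+2) (conf (n+2) y))))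
      = ENNReal.ofReal (hC (fun x => exp (-W x)) (n+1) 0) := by
  have hc := cont_of_cv h.cv
  rw [(h.hC_props (n+1)).2.2.1, ← lint_conf_full _ (fun i => by fun_prop)]
  refine lintegral_congr fun y => ?_
  have := exp_prod W (fun _ _ => 0) (n+2) (conf (n+2) y)
  simp only [zero_sub, Finset.sum_const_zero] at this
  exact this.symm

theorem Nice.Z {W : ℝ → ℝ} {ε B : ℝ} (h : Nice W ε B) (n : ℕ) :
    Zpart W (n+2) = hC (fun x => exp (-W x)) (n+1) 0 := by
  have hc := cont_of_cv h.cv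
  unfold Zpart
  have hm := Ham_meas hc (n+2)
  rw [integral_eq_lintegral_of_nonneg_ae (Eventually.of_forall fun y => (exp_pos _).le)
    (by exact (hm.neg.exp).aestronglyMeasurable)]
  have := h.Zl n
  refine (congrArg ENNReal.toReal this).trans ?_
  exact ENNReal.toReal_ofReal ((h.hC_props (n+1)).2.1 0)

theorem piN_apply (W : ℝ → ℝ) (N : ℕ) {S : Set (ℕ → ℝ)} (hS : MeasurableSet S) :
    piN W N S = ∫⁻ y in conf N ⁻¹' S,
      ENNReal.ofReal (Real.exp (-(Ham W N (conf N y))) / Zpart W N) := by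
  unfold piN
  rw [Measure.map_apply (conf_measurable N) hS, withDensity_apply _ (conf_measurable N hS)]

theorem piN_mono (W : ℝ → ℝ) (N : ℕ) {S T : Set (ℕ → ℝ)} (hS : MeasurableSet S)
    (hT : MeasurableSet T) (h : ∀ y, conf N y ∈ S → conf N y ∈ T) :
    piN W N S ≤ piN W N T := by
  rw [piN_apply W N hS, piN_apply W N hT]
  exact lintegral_mono_set h

theorem Nice.piN_le_one {W : ℝ → ℝ} {ε B : ℝ} (h : Nice W ε B) (n : ℕ) (S : Set (ℕ → ℝ)) :
    piN W (n+2) S ≤ 1 := by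
  have hc := cont_of_cv h.cv
  refine (measure_mono (Set.subset_univ S)).trans ?_
  rw [piN_apply _ _ MeasurableSet.univ, Set.preimage_univ, Measure.restrict_univ, h.Z n]
  obtain ⟨D, hD, hlow⟩ := h.low
  have hpos : 0 < hC (fun x => exp (-W x)) (n+1) 0 := lt_of_lt_of_le (by positivity) (hlow n)
  simp_rw [div_eq_mul_inv, ENNReal.ofReal_mul (exp_pos _).le]
  have hm := Ham_meas hc (n+2)
  rw [lintegral_mul_const _ (by exact hm.neg.exp.ennreal_ofReal)]
  have := h.Zl n
  refine (congrArg (· * ENNReal.ofReal (hC (fun x => exp (-W x)) (n+1) 0)⁻¹) this).le.trans ?_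
  rw [← ENNReal.ofReal_mul hpos.le, mul_inv_cancel₀ hpos.ne']
  simp

theorem Nice.piN_le {W : ℝ → ℝ} {ε B D : ℝ} (h : Nice W ε B) (hD : 0 < D)
    (hlow : ∀ n : ℕ, D / ((n:ℝ) + 2) ^ 2 ≤ hC (fun x => exp (-W x)) (n+1) 0)
    (n : ℕ) {S : Set (ℕ → ℝ)} (hS : MeasurableSet S) (φ : ℕ → ℝ → ℝ) (hφ : ∀ i, Measurable (φ i))
    {r P : ℝ} (_hP : 0 ≤ P)
    (hr : ∀ x ∈ S, x 0 = 0 → r ≤ ∑ i ∈ Finset.range (n+2), φ i (x (i+1) - x i))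
    (hsup : ∀ x, exp (φ (n+1) x - W x) ≤ B)
    (hprod : ∏ i ∈ Finset.range (n+1), ∫⁻ x, ENNReal.ofReal (exp (φ i x - W x))
      ≤ ENNReal.ofReal P) :
    piN W (n+2) S ≤ ENNReal.ofReal (exp (-r) * (((n:ℝ)+2)^2 / D) * (B * P)) := by
  have hc := cont_of_cv h.cv
  have hfm : ∀ i, Measurable (fun x => ENNReal.ofReal (exp (φ i x - W x))) := by
    intro i
    have := hφ i
    fun_prop
  set f : ℕ → ℝ → ENNReal := fun i x => ENNReal.ofReal (exp (φ i x - W x)) with hf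
  set a := exp (-r) * (((n:ℝ)+2)^2 / D) with ha
  have ha0 : 0 ≤ a := by positivity
  have hZ : (Zpart W (n+2))⁻¹ ≤ ((n:ℝ)+2)^2 / D := by
    rw [h.Z n, ← inv_div]
    exact inv_anti₀ (by positivity) (hlow n)
  rw [piN_apply _ _ hS]
  calc _ ≤ ∫⁻ y in conf (n+2) ⁻¹' S, ENNReal.ofReal a * ∏ i ∈ Finset.range (n+2),
        f i (conf (n+2) y (i+1) - conf (n+2) y i) := by
        refine setLIntegral_mono' (conf_measurable _ hS) fun y hy => ?_
        rw [hf, exp_prod W φ, ← ENNReal.ofReal_mul ha0]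
        apply ENNReal.ofReal_le_ofReal
        have h1 := hr _ hy (conf_zero _ _)
        rw [div_eq_mul_inv, ha]
        calc _ ≤ exp (-(Ham W (n+2) (conf (n+2) y))) * (((n:ℝ)+2)^2 / D) := by gcongr
          _ ≤ (exp (-r) * exp ((∑ i ∈ Finset.range (n+2),
                φ i (conf (n+2) y (i+1) - conf (n+2) y i)) - Ham W (n+2) (conf (n+2) y)))
                * (((n:ℝ)+2)^2 / D) := by
              rw [← exp_add]
              gcongr
              linarith
          _ = _ := by ring
    _ ≤ ∫⁻ y, ENNReal.ofReal a * ∏ i ∈ Finset.range (n+2),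
        f i (conf (n+2) y (i+1) - conf (n+2) y i) := setLIntegral_le_lintegral _ _
    _ = ENNReal.ofReal a * Gc f (n+1) 0 := by
        rw [lintegral_const_mul']
        · exact congrArg _ (lint_conf_full f hfm n)
        · exact ENNReal.ofReal_ne_top
    _ ≤ ENNReal.ofReal a * (ENNReal.ofReal B * ENNReal.ofReal P) := by
        gcongr
        refine (Gc_le f hfm n (ENNReal.ofReal B)
          (fun x => ENNReal.ofReal_le_ofReal (hsup x)) 0).trans ?_
        gcongr
    _ = _ := by
        rw [← ENNReal.ofReal_mul h.bpos.le, ← ENNReal.ofReal_mul ha0]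

theorem Nice.single {W : ℝ → ℝ} {ε B D K : ℝ} (h : Nice W ε B) (hD : 0 < D) (hK : 0 < K)
    (hlow : ∀ n : ℕ, D / ((n:ℝ) + 2) ^ 2 ≤ hC (fun x => exp (-W x)) (n+1) 0)
    (hmgf : ∀ s : ℝ, |s| ≤ ε / 4 →
      ∫⁻ x, ENNReal.ofReal (exp (s * x - W x)) ≤ ENNReal.ofReal (1 + K * s ^ 2))
    (n k : ℕ) (hk : k ≤ n + 1) (σ r : ℝ) (hσ : |σ| ≤ ε / 4) :
    piN W (n+2) {x | r ≤ σ * x k} ≤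
      ENNReal.ofReal (exp (-r) * (((n:ℝ)+2)^2 / D) * (B * exp (K * σ^2 * ((n:ℝ)+2)))) := by
  refine h.piN_le hD hlow n ?_ (fun i x => (if i < k then σ else 0) * x) (fun i => by fun_prop)
    (exp_pos _).le ?_ ?_ ?_
  · exact measurableSet_le measurable_const
      (show Measurable (fun x : ℕ → ℝ => σ * x k) by fun_prop)
  · intro x hx h0
    have hx' : r ≤ σ * x k := hx
    refine hx'.trans (le_of_eq ?_)
    have hsub : Finset.range k ⊆ Finset.range (n+2) := by
      intro i; simp only [Finset.mem_range]; omega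
    rw [← Finset.sum_subset hsub (f := fun i => (if i < k then σ else 0) * (x (i+1) - x i))]
    · have : ∑ i ∈ Finset.range k, (if i < k then σ else 0) * (x (i+1) - x i)
          = ∑ i ∈ Finset.range k, σ * (x (i+1) - x i) := by
        refine Finset.sum_congr rfl fun i hi => ?_
        rw [if_pos (Finset.mem_range.1 hi)]
      rw [this, ← Finset.mul_sum, Finset.sum_range_sub, h0, sub_zero]
    · intro i _ hi
      rw [if_neg (by simpa using hi), zero_mul]
  · intro x
    rw [if_neg (by omega), zero_mul, zero_sub]
    exact h.le x
  · calc _ ≤ ∏ i ∈ Finset.range (n+1), ENNReal.ofReal (exp (K * σ^2)) := by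
          refine Finset.prod_le_prod' fun i _ => ?_
          by_cases hi : i < k
          · simp only [hi, if_true]
            refine (hmgf σ hσ).trans (ENNReal.ofReal_le_ofReal ?_)
            have := add_one_le_exp (K * σ^2)
            linarith
          · simp only [hi, if_false, zero_mul, zero_sub]
            rw [h.one]
            exact ENNReal.one_le_ofReal.2 (one_le_exp (by positivity))
      _ = ENNReal.ofReal (exp (((n+1:ℕ):ℝ) * (K * σ^2))) := by
          rw [Finset.prod_const, Finset.card_range, ← ENNReal.ofReal_pow (exp_pos _).le,
            ← exp_nat_mul]
      _ ≤ _ := by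
          apply ENNReal.ofReal_le_ofReal
          rw [exp_le_exp]
          push_cast
          have : 0 ≤ K * σ^2 := by positivity
          nlinarith

theorem Nice.partA {W : ℝ → ℝ} {ε B : ℝ} (h : Nice W ε B) :
    ∃ c > 0, ∃ D > 0, ∀ n : ℕ, ∀ u : ℝ, 0 < u →
      piN W (n+2) {x : ℕ → ℝ | ∃ k ≤ n+2, u * sqrt ((n+2:ℕ):ℝ) ≤ |x k|} ≤
        ENNReal.ofReal (D * ((n+2:ℕ):ℝ)^3 * exp (-c * min (u^2) (sqrt ((n+2:ℕ):ℝ) * u))) := by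
  obtain ⟨K, hK, hmgf⟩ := h.mgf
  obtain ⟨D, hD, hlow⟩ := h.low
  have hε := h.eps
  have hB := h.bpos
  set δ := min (ε/4) (1/(2*K)) with hδ
  have hδ0 : 0 < δ := by rw [hδ]; positivity
  have hδε : δ ≤ ε/4 := min_le_left _ _
  have hδK : K * δ ≤ 1/2 := by
    have : δ ≤ 1/(2*K) := min_le_right _ _
    rw [le_div_iff₀ (by positivity)] at this
    linarith
  refine ⟨δ/2, by positivity, 2 * B / D, by positivity, fun n u hu => ?_⟩
  set R : ℝ := sqrt ((n+2:ℕ):ℝ) with hR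
  have hRR : R^2 = (n:ℝ) + 2 := by rw [hR, sq_sqrt (by positivity)]; push_cast; ring
  have hR0 : 0 < R := by rw [hR]; positivity
  set m := min (u^2) (R*u) with hm
  obtain ⟨s, hs0, hsε, hsm⟩ : ∃ s, 0 ≤ s ∧ s ≤ ε/4 ∧
      -(s * (u * R)) + K * s^2 * ((n:ℝ)+2) ≤ -(δ/2) * m := by
    rcases le_total u R with hle | hle
    · refine ⟨δ * u / R, by positivity, ?_, ?_⟩
      · refine le_trans ?_ hδε
        rw [div_le_iff₀ hR0]
        gcongr
      · have e1 : δ * u / R * (u * R) = δ * u^2 := by field_simp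
        have e2 : K * (δ * u / R)^2 * ((n:ℝ)+2) = (K * δ) * (δ * u^2) := by
          rw [← hRR]; field_simp
        rw [e1, e2]
        have h1 : m ≤ u^2 := min_le_left _ _
        have h2 : (K * δ) * (δ * u^2) ≤ 1/2 * (δ * u^2) := by gcongr
        nlinarith
    · refine ⟨δ, hδ0.le, hδε, ?_⟩
      rw [← hRR]
      have h1 : m ≤ R * u := min_le_right _ _
      have h2 : K * δ^2 * R^2 ≤ 1/2 * (δ * (R * u)) := by
        calc _ = (K * δ) * (δ * (R * R)) := by ring
          _ ≤ _ := by gcongr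
      nlinarith
  have hsingle : ∀ k ∈ Finset.Icc 1 (n+1),
      piN W (n+2) ({x | s * (u*R) ≤ s * x k} ∪ {x | s * (u*R) ≤ (-s) * x k}) ≤
      ENNReal.ofReal (2 * B / D * ((n:ℝ)+2)^2 * exp (-(δ/2) * m)) := by
    intro k hk
    have hk' := (Finset.mem_Icc.1 hk).2
    refine (measure_union_le _ _).trans ?_
    have a1 := h.single hD hK hlow hmgf n k hk' s (s * (u*R)) (by rwa [abs_of_nonneg hs0])
    have a2 := h.single hD hK hlow hmgf n k hk' (-s) (s * (u*R))
      (by rwa [abs_neg, abs_of_nonneg hs0])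
    rw [neg_sq] at a2
    refine (add_le_add a1 a2).trans ?_
    rw [← ENNReal.ofReal_add (by positivity) (by positivity)]
    apply ENNReal.ofReal_le_ofReal
    have e : exp (-(s * (u*R))) * exp (K * s^2 * ((n:ℝ)+2)) ≤ exp (-(δ/2) * m) := by
      rw [← exp_add, exp_le_exp]; exact hsm
    calc _ = 2 * B / D * ((n:ℝ)+2)^2 * (exp (-(s * (u*R))) * exp (K * s^2 * ((n:ℝ)+2))) := by
          field_simp; ring
      _ ≤ _ := by gcongr
  have hmeasA : ∀ k, MeasurableSet {x : ℕ → ℝ | u * R ≤ |x k|} := fun k =>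
    measurableSet_le measurable_const (measurable_pi_apply k).abs
  calc _ ≤ piN W (n+2) (⋃ k ∈ Finset.Icc 1 (n+1),
        ({x | s * (u*R) ≤ s * x k} ∪ {x | s * (u*R) ≤ (-s) * x k})) := by
        refine piN_mono _ _ ?_ ?_ ?_
        · have : {x : ℕ → ℝ | ∃ k ≤ n+2, u * R ≤ |x k|}
              = ⋃ k, ⋃ (_ : k ≤ n+2), {x : ℕ → ℝ | u * R ≤ |x k|} := by
            ext x; simp
          rw [this]
          exact MeasurableSet.iUnion fun k => MeasurableSet.iUnion fun _ => hmeasA k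
        · refine Finset.measurableSet_biUnion _ fun k _ => ?_
          refine MeasurableSet.union ?_ ?_
          · exact measurableSet_le measurable_const ((measurable_pi_apply k).const_mul _)
          · exact measurableSet_le measurable_const ((measurable_pi_apply k).const_mul _)
        · rintro y ⟨k, hk, hky⟩
          have huR : 0 < u * R := by positivity
          have hk1 : 1 ≤ k := by
            by_contra hcon
            have : k = 0 := by omega
            rw [this, conf_zero, abs_zero] at hky
            linarith
          have hk2 : k ≤ n + 1 := by
            by_contra hcon
            have : k = n+2 := by omega
            rw [this, conf_last _ (by omega), abs_zero] at hky
            linarith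
          simp only [Set.mem_iUnion]
          refine ⟨k, Finset.mem_Icc.2 ⟨hk1, hk2⟩, ?_⟩
          rcases le_abs.1 hky with h1 | h1
          · left
            exact mul_le_mul_of_nonneg_left h1 hs0
          · right
            have := mul_le_mul_of_nonneg_left h1 hs0
            simp only [Set.mem_ofPred_eq]
            linarith
    _ ≤ ∑ k ∈ Finset.Icc 1 (n+1), piN W (n+2)
        ({x | s * (u*R) ≤ s * x k} ∪ {x | s * (u*R) ≤ (-s) * x k}) :=
        measure_biUnion_finset_le _ _
    _ ≤ ∑ k ∈ Finset.Icc 1 (n+1),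
        ENNReal.ofReal (2 * B / D * ((n:ℝ)+2)^2 * exp (-(δ/2) * m)) :=
        Finset.sum_le_sum hsingle
    _ = ENNReal.ofReal (((n+1:ℕ):ℝ) * (2 * B / D * ((n:ℝ)+2)^2 * exp (-(δ/2) * m))) := by
        rw [Finset.sum_const, Nat.card_Icc, nsmul_eq_mul, ENNReal.ofReal_mul (p := ((n+1:ℕ):ℝ)) (by positivity),
          ENNReal.ofReal_natCast]
        simp
    _ ≤ _ := by
        apply ENNReal.ofReal_le_ofReal
        push_cast
        calc _ ≤ ((n:ℝ)+2) * (2 * B / D * ((n:ℝ)+2)^2 * exp (-(δ/2) * m)) := by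
              gcongr; norm_num
          _ = _ := by ring

theorem Nice.partB {W : ℝ → ℝ} {ε B : ℝ} (h : Nice W ε B) :
    ∃ c > 0, ∃ D > 0, ∀ n : ℕ, ∀ u : ℝ, 0 < u →
      piN W (n+2) {x : ℕ → ℝ | ∃ k : ℕ, 1 ≤ k ∧ k ≤ n+2 ∧ u ≤ |x k - x (k - 1)|} ≤
        ENNReal.ofReal (D * ((n+2:ℕ):ℝ)^3 * exp (-c * u)) := by
  obtain ⟨D, hD, hlow⟩ := h.low
  have hε := h.eps
  have hB := h.bpos
  have hc := cont_of_cv h.cv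
  have hptw : ∀ x, exp (ε/2 * |x| - W x) ≤ B * exp (-(ε/2 * |x|)) := by
    intro x
    calc _ = exp (ε/2 * |x|) * exp (-W x) := by rw [← exp_add]; rfl
      _ ≤ exp (ε/2 * |x|) * (B * exp (-(ε * |x|))) := by gcongr; exact h.dec x
      _ = B * (exp (ε/2 * |x|) * exp (-(ε * |x|))) := by ring
      _ = _ := by rw [← exp_add]; congr 2; ring
  have hI := (integrable_exp_abs (c := ε/2) (by positivity)).const_mul B
  set A := max 1 (∫ x, B * exp (-(ε/2 * |x|))) with hA
  have hA1 : 1 ≤ A := le_max_left _ _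
  have hAint : ∫⁻ x, ENNReal.ofReal (exp (ε/2 * |x| - W x)) ≤ ENNReal.ofReal A := by
    calc _ ≤ ∫⁻ x, ENNReal.ofReal (B * exp (-(ε/2 * |x|))) :=
          lintegral_mono fun x => ENNReal.ofReal_le_ofReal (hptw x)
      _ = ENNReal.ofReal (∫ x, B * exp (-(ε/2 * |x|))) := by
          rw [ofReal_integral_eq_lintegral_ofReal hI
            (Eventually.of_forall fun x => by positivity)]
      _ ≤ _ := ENNReal.ofReal_le_ofReal (le_max_right _ _)
  refine ⟨ε/2, by positivity, B * A / D, by positivity, fun n u hu => ?_⟩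
  have hmeas : ∀ j, MeasurableSet {x : ℕ → ℝ | u ≤ |x (j+1) - x j|} := fun j =>
    measurableSet_le measurable_const ((measurable_pi_apply (j+1)).sub (measurable_pi_apply j)).abs
  have hsingle : ∀ j ∈ Finset.range (n+2), piN W (n+2) {x : ℕ → ℝ | u ≤ |x (j+1) - x j|} ≤
      ENNReal.ofReal (exp (-(ε/2 * u)) * (((n:ℝ)+2)^2 / D) * (B * A)) := by
    intro j hj
    refine h.piN_le hD hlow n (hmeas j) (fun i x => if i = j then ε/2 * |x| else 0)
      (fun i => by split_ifs <;> fun_prop) (by linarith) ?_ ?_ ?_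
    · intro x hx _
      rw [Finset.sum_ite_eq' , if_pos hj]
      have hx' : u ≤ |x (j+1) - x j| := hx
      gcongr
    · intro x
      split_ifs
      · refine (hptw x).trans ?_
        have : exp (-(ε/2 * |x|)) ≤ 1 := by
          rw [exp_le_one_iff]
          have : 0 ≤ ε/2 * |x| := by positivity
          linarith
        nlinarith
      · rw [zero_sub]; exact h.le x
    · calc _ ≤ ∏ i ∈ Finset.range (n+1), (if i = j then ENNReal.ofReal A else 1) := by
            refine Finset.prod_le_prod' fun i _ => ?_
            split_ifs
            · exact hAint
            · simp only [zero_sub]; rw [h.one]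
        _ ≤ _ := by
            rw [Finset.prod_ite_eq']
            split_ifs
            · exact le_rfl
            · exact ENNReal.one_le_ofReal.2 hA1
  calc _ ≤ piN W (n+2) (⋃ j ∈ Finset.range (n+2), {x : ℕ → ℝ | u ≤ |x (j+1) - x j|}) := by
        apply measure_mono
        rintro x ⟨k, hk1, hk2, hk⟩
        simp only [Set.mem_iUnion]
        refine ⟨k - 1, Finset.mem_range.2 (by omega), ?_⟩
        simp only [Set.mem_ofPred_eq]
        rwa [Nat.sub_add_cancel hk1]
    _ ≤ ∑ j ∈ Finset.range (n+2), piN W (n+2) {x : ℕ → ℝ | u ≤ |x (j+1) - x j|} :=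
        measure_biUnion_finset_le _ _
    _ ≤ ∑ j ∈ Finset.range (n+2),
        ENNReal.ofReal (exp (-(ε/2 * u)) * (((n:ℝ)+2)^2 / D) * (B * A)) :=
        Finset.sum_le_sum hsingle
    _ = ENNReal.ofReal (((n+2:ℕ):ℝ) * (exp (-(ε/2 * u)) * (((n:ℝ)+2)^2 / D) * (B * A))) := by
        rw [Finset.sum_const, Finset.card_range, nsmul_eq_mul,
          ENNReal.ofReal_mul (p := ((n+2:ℕ):ℝ)) (by positivity),
          ENNReal.ofReal_natCast]
    _ = _ := by
        congr 1
        push_cast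
        rw [neg_mul]
        field_simp

theorem conv_lin {W : ℝ → ℝ} (hW : ConvexOn ℝ Set.univ W) {x1 x : ℝ} (h1 : 0 < x1) (hx : x1 ≤ x) :
    W 0 + (W x1 - W 0) / x1 * x ≤ W x := by
  have hx0 : 0 < x := by linarith
  have a1 : 0 ≤ 1 - x1 / x := by rw [sub_nonneg, div_le_one hx0]; exact hx
  have a2 : 0 ≤ x1 / x := by positivity
  have h := hW.2 (Set.mem_univ 0) (Set.mem_univ x) a1 a2 (by ring)
  simp only [smul_eq_mul, mul_zero, zero_add] at h
  rw [div_mul_cancel₀ _ hx0.ne'] at h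
  have h2 : x * W x1 ≤ (x - x1) * W 0 + x1 * W x := by
    have := mul_le_mul_of_nonneg_left h hx0.le
    have e : x * ((1 - x1 / x) * W 0 + x1 / x * W x) = (x - x1) * W 0 + x1 * W x := by
      field_simp
    linarith
  have h3 : (W x1 - W 0) / x1 * x = (x * W x1 - x * W 0) / x1 := by ring
  rw [h3, ← le_sub_iff_add_le', div_le_iff₀ h1]
  linarith

theorem conv_decay_one {W : ℝ → ℝ} (hW : ConvexOn ℝ Set.univ W)
    (hI : ∫⁻ x, ENNReal.ofReal (exp (-W x)) ≠ ⊤) : ∃ x1 > 0, ∃ ε > 0, ∀ x ≥ x1,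
      W 0 + ε * x ≤ W x := by
  have : ∃ x1 > 0, W 0 < W x1 := by
    by_contra hcon
    push Not at hcon
    apply hI
    rw [eq_top_iff]
    calc (⊤ : ENNReal) = ∫⁻ x in Set.Ioi (0:ℝ), ENNReal.ofReal (exp (-W 0)) := by
          rw [setLIntegral_const, Real.volume_Ioi, ENNReal.mul_top]
          simpa using exp_pos _
      _ ≤ ∫⁻ x in Set.Ioi (0:ℝ), ENNReal.ofReal (exp (-W x)) := by
          refine setLIntegral_mono' measurableSet_Ioi fun x hx => ?_
          have := hcon x hx
          gcongr
      _ ≤ _ := setLIntegral_le_lintegral _ _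
  obtain ⟨x1, h1, h2⟩ := this
  exact ⟨x1, h1, (W x1 - W 0) / x1, div_pos (by linarith) h1, fun x hx => conv_lin hW h1 hx⟩

theorem conv_decay {W : ℝ → ℝ} (hW : ConvexOn ℝ Set.univ W)
    (hI : ∫⁻ x, ENNReal.ofReal (exp (-W x)) ≠ ⊤) : ∃ ε > 0, ∃ B > 0, ∀ x,
      exp (-W x) ≤ B * exp (-(ε * |x|)) := by
  have hc := cont_of_cv hW
  obtain ⟨x1, h1, e1, he1, H1⟩ := conv_decay_one hW hI
  have hW' : ConvexOn ℝ Set.univ (fun x => W (-x)) := by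
    refine ⟨convex_univ, fun x _ y _ a b ha hb hab => ?_⟩
    have := hW.2 (Set.mem_univ (-x)) (Set.mem_univ (-y)) ha hb hab
    have e : -(a • x + b • y) = a • (-x) + b • (-y) := by simp only [smul_eq_mul]; ring
    simp only
    rw [e]
    exact this
  obtain ⟨x2, h2, e2, he2, H2⟩ := conv_decay_one hW' (by
    rw [lintegral_neg_eq_self (fun x => ENNReal.ofReal (exp (-W x)))]; exact hI)
  simp only [neg_zero] at H2
  set ε := min e1 e2 with hε
  have hε0 : 0 < ε := lt_min he1 he2
  obtain ⟨B1, hB1⟩ := (isCompact_Icc (a := -x2) (b := x1)).bddAbove_image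
    (f := fun x => exp (ε * |x| - W x)) (by fun_prop)
  refine ⟨ε, hε0, max B1 (exp (-W 0)), lt_max_of_lt_right (exp_pos _), fun x => ?_⟩
  rcases le_or_gt x1 x with hx | hx
  · have h3 := H1 x hx
    have hx0 : 0 < x := by linarith
    calc exp (-W x) ≤ exp (-W 0) * exp (-(ε * |x|)) := by
          rw [← exp_add, exp_le_exp, abs_of_pos hx0]
          have : ε * x ≤ e1 * x := by gcongr; exact min_le_left _ _
          linarith
      _ ≤ _ := by gcongr; exact le_max_right _ _
  rcases le_or_gt x (-x2) with hx2 | hx2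
  · have h3 := H2 (-x) (by linarith)
    rw [neg_neg] at h3
    have hx0 : x < 0 := by linarith
    calc exp (-W x) ≤ exp (-W 0) * exp (-(ε * |x|)) := by
          rw [← exp_add, exp_le_exp, abs_of_neg hx0]
          have : ε * (-x) ≤ e2 * (-x) := by
            have : ε ≤ e2 := min_le_right _ _
            nlinarith
          linarith
      _ ≤ _ := by gcongr; exact le_max_right _ _
  · have h3 : exp (ε * |x| - W x) ≤ B1 := hB1 ⟨x, ⟨hx2.le, hx.le⟩, rfl⟩
    calc exp (-W x) = exp (ε * |x| - W x) * exp (-(ε * |x|)) := by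
          rw [← exp_add]; congr 1; ring
      _ ≤ _ := by gcongr; exact h3.trans (le_max_left _ _)

theorem exists_finite {V : ℝ → ℝ} (hV : InClassC V) :
    ∃ γ : ℝ, ∫⁻ x, ENNReal.ofReal (exp (γ * x - V x)) ≠ ⊤ := by
  have hc := cont_of_cv hV.convex
  obtain ⟨vm, vp, hm, hp, hlt⟩ := hV.slopes
  obtain ⟨α, hα1, hα2⟩ := EReal.lt_iff_exists_real_btwn.1 hlt
  obtain ⟨β, hβ1, hβ2⟩ := EReal.lt_iff_exists_real_btwn.1 hα2
  have hαβ : α < β := by exact_mod_cast hβ1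
  have ep := hp.eventually (lt_mem_nhds hβ2)
  have em := hm.eventually (gt_mem_nhds hα1)
  obtain ⟨R1, hR1⟩ := eventually_atTop.1 (ep.and (eventually_gt_atTop 0))
  obtain ⟨R2, hR2⟩ := eventually_atBot.1 (em.and (eventually_lt_atBot 0))
  set γ := (α+β)/2 with hγ
  set η := (β-α)/2 with hη
  have hη0 : 0 < η := by rw [hη]; linarith
  obtain ⟨B1, hB1⟩ := (isCompact_Icc (a := R2) (b := R1)).bddAbove_image
    (f := fun x => exp (η * |x| + γ * x - V x)) (by fun_prop)
  have hbd : ∀ x, exp (γ * x - V x) ≤ max B1 1 * exp (-(η * |x|)) := by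
    intro x
    rcases le_or_gt R1 x with hx | hx
    · obtain ⟨h1, h2⟩ := hR1 x hx
      have h1' : β < V x / x := by exact_mod_cast h1
      rw [lt_div_iff₀ h2] at h1'
      calc _ ≤ 1 * exp (-(η * |x|)) := by
            rw [one_mul, exp_le_exp, abs_of_pos h2]
            have : η * x = β * x - γ * x := by rw [hη, hγ]; ring
            linarith
        _ ≤ _ := by gcongr; exact le_max_right _ _
    rcases le_or_gt x R2 with hx2 | hx2
    · obtain ⟨h1, h2⟩ := hR2 x hx2
      have h1' : V x / x < α := by exact_mod_cast h1
      rw [div_lt_iff_of_neg h2] at h1'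
      calc _ ≤ 1 * exp (-(η * |x|)) := by
            rw [one_mul, exp_le_exp, abs_of_neg h2]
            have : η * x = γ * x - α * x := by rw [hη, hγ]; ring
            linarith
        _ ≤ _ := by gcongr; exact le_max_right _ _
    · have h3 : exp (η * |x| + γ * x - V x) ≤ B1 := hB1 ⟨x, ⟨hx2.le, hx.le⟩, rfl⟩
      calc _ = exp (η * |x| + γ * x - V x) * exp (-(η * |x|)) := by
            rw [← exp_add]; congr 1; ring
        _ ≤ _ := by gcongr; exact h3.trans (le_max_left _ _)
  refine ⟨γ, ne_of_lt ?_⟩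
  have hI := (integrable_exp_abs hη0).const_mul (max B1 1)
  calc _ ≤ ∫⁻ x, ENNReal.ofReal (max B1 1 * exp (-(η * |x|))) :=
        lintegral_mono fun x => ENNReal.ofReal_le_ofReal (hbd x)
    _ < ⊤ := by
        have := hI.2
        rwa [hasFiniteIntegral_iff_ofReal (Eventually.of_forall fun x => by
          have : 0 < max B1 1 := lt_max_of_lt_right one_pos
          positivity)] at this

theorem exists_min {V : ℝ → ℝ} (hc : Continuous V) {γ : ℝ}
    (hγ : ∫⁻ x, ENNReal.ofReal (exp (γ * x - V x)) ≠ ⊤) :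
    ∃ a : ℝ, ∀ b : ℝ, ∫⁻ x, ENNReal.ofReal (exp (a * x - V x)) ≤
      ∫⁻ x, ENNReal.ofReal (exp (b * x - V x)) := by
  set M : ℝ → ENNReal := fun a => ∫⁻ x, ENNReal.ofReal (exp (a * x - V x)) with hM
  obtain ⟨B1, hB1⟩ := (isCompact_Icc (a := (-2:ℝ)) (b := 2)).bddAbove_image
    (f := fun x => V x) (by fun_prop)
  have hcoer : ∀ a, ENNReal.ofReal (exp (|a| - B1)) ≤ M a := by
    have key : ∀ a l : ℝ, (∀ x ∈ Set.Icc l (l+1), |a| ≤ a * x ∧ x ∈ Set.Icc (-2:ℝ) 2) →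
        ENNReal.ofReal (exp (|a| - B1)) ≤ M a := by
      intro a l hl
      calc ENNReal.ofReal (exp (|a| - B1))
          = ∫⁻ x in Set.Icc l (l+1), ENNReal.ofReal (exp (|a| - B1)) := by
            rw [setLIntegral_const, Real.volume_Icc]; simp
        _ ≤ ∫⁻ x in Set.Icc l (l+1), ENNReal.ofReal (exp (a * x - V x)) := by
            refine setLIntegral_mono' measurableSet_Icc fun x hx => ?_
            obtain ⟨h1, h2⟩ := hl x hx
            have h3 : V x ≤ B1 := hB1 ⟨x, h2, rfl⟩
            apply ENNReal.ofReal_le_ofReal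
            rw [exp_le_exp]
            linarith
        _ ≤ _ := setLIntegral_le_lintegral _ _
    intro a
    rcases le_total 0 a with ha | ha
    · refine key a 1 fun x hx => ⟨?_, ?_⟩
      · rw [abs_of_nonneg ha]; nlinarith [hx.1]
      · exact ⟨by linarith [hx.1], by linarith [hx.2]⟩
    · refine key a (-2) fun x hx => ⟨?_, ?_⟩
      · rw [abs_of_nonpos ha]; nlinarith [hx.2]
      · exact ⟨by linarith [hx.1], by linarith [hx.2]⟩
  set T : Set ℝ := {a | M a ≤ M γ} with hT
  obtain ⟨v, -, hv, hvm⟩ := exists_seq_tendsto_sInf (S := M '' T)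
    ⟨M γ, γ, (le_refl (M γ) : M γ ≤ M γ), rfl⟩ (OrderBot.bddBelow _)
  choose a ha hav using hvm
  have hbd : ∀ n, a n ∈ Set.Icc (-(log (M γ).toReal + B1)) (log (M γ).toReal + B1) := by
    intro n
    rw [Set.mem_Icc, ← abs_le]
    have h1 := (hcoer (a n)).trans (ha n)
    have h2 := (ENNReal.ofReal_le_iff_le_toReal hγ).1 h1
    have h3 := (le_log_iff_exp_le (lt_of_lt_of_le (exp_pos _) h2)).2 h2
    linarith
  obtain ⟨b, -, φ, hφ, hb⟩ := isCompact_Icc.tendsto_subseq hbd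
  refine ⟨b, fun d => ?_⟩
  have hmin : M b ≤ sInf (M '' T) := by
    have hlim : ∀ x, Tendsto (fun n => ENNReal.ofReal (exp (a (φ n) * x - V x))) atTop
        (nhds (ENNReal.ofReal (exp (b * x - V x)))) := by
      intro x
      refine ENNReal.tendsto_ofReal ?_
      have : Continuous (fun t : ℝ => exp (t * x - V x)) := by fun_prop
      exact (this.tendsto b).comp hb
    have hfat := lintegral_liminf_le (μ := volume) (u := atTop)
      (f := fun n x => ENNReal.ofReal (exp (a (φ n) * x - V x))) (fun n => by fun_prop)
    simp_rw [fun x => (hlim x).liminf_eq] at hfat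
    refine hfat.trans (le_of_eq ?_)
    have h4 : Tendsto (fun n => M (a (φ n))) atTop (nhds (sInf (M '' T))) := by
      have : (fun n => M (a (φ n))) = v ∘ φ := by
        ext n; exact hav (φ n)
      rw [this]
      exact hv.comp hφ.tendsto_atTop
    exact h4.liminf_eq
  change M b ≤ M d
  have hγm : sInf (M '' T) ≤ M γ := sInf_le ⟨γ, (le_refl (M γ) : M γ ≤ M γ), rfl⟩
  by_cases hd : M d ≤ M γ
  · exact hmin.trans (sInf_le ⟨d, hd, rfl⟩)
  · exact hmin.trans (hγm.trans (not_le.1 hd).le)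

theorem exists_nice {V : ℝ → ℝ} (hV : InClassC V) :
    ∃ a b ε B : ℝ, Nice (fun x => V x - a * x + b) ε B := by
  have hc := cont_of_cv hV.convex
  obtain ⟨γ, hγ⟩ := exists_finite hV
  obtain ⟨a, ha⟩ := exists_min hc hγ
  set M0 := ∫⁻ x, ENNReal.ofReal (exp (a * x - V x)) with hM0
  have hfin : M0 ≠ ⊤ := ne_of_lt ((ha γ).trans_lt (lt_top_iff_ne_top.2 hγ))
  have hpos : M0 ≠ 0 := by
    intro h0
    rw [hM0, lintegral_eq_zero_iff (by fun_prop)] at h0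
    have : ∀ᵐ x : ℝ, False := by
      filter_upwards [h0] with x hx
      have : exp (a * x - V x) ≤ 0 := by simpa using hx
      exact absurd this (not_le.2 (exp_pos _))
    simp at this
    have h9 := Real.volume_Ioi (a := (0:ℝ))
    rw [this] at h9
    simp at h9
  have hr : 0 < M0.toReal := ENNReal.toReal_pos hpos hfin
  have hcv : ∀ b, ConvexOn ℝ Set.univ (fun x => V x - a * x + b) := by
    intro b
    refine ⟨convex_univ, fun x _ y _ s t hs ht hst => ?_⟩
    have := hV.convex.2 (Set.mem_univ x) (Set.mem_univ y) hs ht hst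
    simp only [smul_eq_mul] at this ⊢
    have e : b = s * b + t * b := by rw [← add_mul, hst, one_mul]
    linarith
  have hshift : ∀ s, ∫⁻ x, ENNReal.ofReal (exp (s * x - (V x - a * x + log M0.toReal)))
      = (∫⁻ x, ENNReal.ofReal (exp ((a + s) * x - V x))) * M0⁻¹ := by
    intro s
    rw [← lintegral_mul_const _ (by fun_prop)]
    refine lintegral_congr fun x => ?_
    have e : M0⁻¹ = ENNReal.ofReal (exp (-log M0.toReal)) := by
      rw [exp_neg, exp_log hr, ENNReal.ofReal_inv_of_pos hr, ENNReal.ofReal_toReal hfin]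
    rw [e, ← ENNReal.ofReal_mul (exp_pos _).le, ← exp_add]
    congr 2
    ring
  have hone : ∫⁻ x, ENNReal.ofReal (exp (-(V x - a * x + log M0.toReal))) = 1 := by
    have := hshift 0
    simp only [zero_mul, zero_sub, add_zero] at this
    rw [this]
    exact ENNReal.mul_inv_cancel hpos hfin
  obtain ⟨ε, hε, B, hB, hdec⟩ := conv_decay (hcv (log M0.toReal)) (by rw [hone]; simp)
  refine ⟨a, log M0.toReal, ε, B, hcv _, hone, fun s => ?_, hε, hB, hdec⟩
  rw [hshift, ← ENNReal.mul_inv_cancel hpos hfin]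
  gcongr
  exact ha _

theorem piN_tilt (V : ℝ → ℝ) (a b : ℝ) (N : ℕ) (hN : 1 ≤ N) :
    piN V N = piN (fun x => V x - a * x + b) N := by
  have hH : ∀ y, Ham (fun x => V x - a * x + b) N (conf N y) = Ham V N (conf N y) + N * b := by
    intro y
    unfold Ham
    rw [Finset.sum_add_distrib, Finset.sum_sub_distrib, ← Finset.mul_sum, Finset.sum_range_sub,
      conf_last N hN, conf_zero]
    simp
  have he : ∀ y, exp (-(Ham (fun x => V x - a * x + b) N (conf N y)))
      = exp (-(Ham V N (conf N y))) * exp (-(N * b)) := by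
    intro y
    rw [hH, ← exp_add]; congr 1; ring
  have hZ : Zpart (fun x => V x - a * x + b) N = Zpart V N * exp (-(N * b)) := by
    unfold Zpart
    simp_rw [he]
    rw [integral_mul_const]
  unfold piN
  simp_rw [he, hZ, mul_div_mul_right _ _ (exp_pos (-(N * b))).ne']

theorem num_comb {X : ENNReal} {D c c' C m N : ℝ} (q : ℕ) (h1 : X ≤ 1) (hD : 0 ≤ D)
    (h2 : X ≤ ENNReal.ofReal (D * N^(q+1) * exp (-c' * m))) (hc : 0 ≤ c)
    (hcc : ((q:ℝ)+1) * c ≤ c') (hC1 : 1 ≤ C) (hDC : D ≤ C) (hm : 0 ≤ m) (hN : 1 ≤ N) :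
    X ≤ ENNReal.ofReal (C * N * exp (-c * m)) := by
  rcases le_or_gt (exp (c*m)) N with h | h
  · refine h1.trans (ENNReal.one_le_ofReal.2 ?_)
    have : 1 ≤ N * exp (-c*m) := by
      have e : exp (c*m) * exp (-c*m) = 1 := by rw [← exp_add]; simp
      rw [← e]
      gcongr
    rw [mul_assoc]
    nlinarith
  · refine h2.trans (ENNReal.ofReal_le_ofReal ?_)
    have hq : N^q ≤ exp (c*m)^q := by gcongr
    rw [← exp_nat_mul] at hq
    calc D * N^(q+1) * exp (-c' * m) = D * N * (N^q * exp (-c' * m)) := by ring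
      _ ≤ C * N * (exp (q * (c*m)) * exp (-c' * m)) := by gcongr
      _ ≤ C * N * exp (-c*m) := by
          rw [← exp_add]
          gcongr
          nlinarith

/-- **Equilibrium tail bounds.** For `V ∈ 𝒞` there are `c, C > 0` such that for all `N ≥ 2` and
`u > 0`: (a) `π_N(‖x‖_∞ ≥ u√N) ≤ C N e^{-c min(u², √N u)}`, and
(b) `π_N(max_i |η_i| ≥ u) ≤ N e^{-c u}` where `η_i = x_i - x_{i-1}`. -/
theorem equilibrium_tail_bounds (V : ℝ → ℝ) (hV : InClassC V) :
    ∃ c > (0 : ℝ), ∃ C > (0 : ℝ), ∀ N : ℕ, 2 ≤ N → ∀ u : ℝ, 0 < u →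
      piN V N {x : ℕ → ℝ | ∃ k ≤ N, u * Real.sqrt N ≤ |x k|} ≤
        ENNReal.ofReal (C * N * Real.exp (-c * min (u ^ 2) (Real.sqrt N * u))) ∧
      piN V N {x : ℕ → ℝ | ∃ k : ℕ, 1 ≤ k ∧ k ≤ N ∧ u ≤ |x k - x (k - 1)|} ≤
        ENNReal.ofReal ((N : ℝ) * Real.exp (-c * u)) := by
  obtain ⟨a, b, ε, B, h⟩ := exists_nice hV
  obtain ⟨c1, hc1, D1, hD1, hA⟩ := h.partA
  obtain ⟨c2, hc2, D2, hD2, hB⟩ := h.partB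
  obtain ⟨j, hj⟩ := pow_unbounded_of_one_lt D2 (one_lt_two : (1:ℝ) < 2)
  have hj3 : (0:ℝ) < 3 + j := by positivity
  have hcpos : 0 < min (c1 / 3) (c2 / (3 + j)) := lt_min (by positivity) (by positivity)
  refine ⟨min (c1 / 3) (c2 / (3 + j)), hcpos, max 1 D1, by positivity, ?_⟩
  intro N hN u hu
  obtain ⟨n, rfl⟩ : ∃ n, N = n + 2 := ⟨N - 2, by omega⟩
  have hN1 : (1:ℝ) ≤ ((n+2:ℕ):ℝ) := by exact_mod_cast (by omega : 1 ≤ n + 2)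
  have hN2 : (2:ℝ) ≤ ((n+2:ℕ):ℝ) := by exact_mod_cast (by omega : 2 ≤ n + 2)
  rw [piN_tilt V a b (n+2) (by omega)]
  constructor
  · refine num_comb 2 (h.piN_le_one n _) hD1.le (hA n u hu) hcpos.le ?_ (le_max_left _ _)
      (le_max_right _ _) (by positivity) hN1
    have := min_le_left (c1 / 3) (c2 / (3 + j))
    push_cast
    linarith
  · have key : D2 * ((n+2:ℕ):ℝ)^3 ≤ 1 * ((n+2:ℕ):ℝ)^(j+2+1) := by
      have h1 : (2:ℝ)^j ≤ ((n+2:ℕ):ℝ)^j := pow_le_pow_left₀ (by norm_num) hN2 j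
      have h2 : D2 ≤ ((n+2:ℕ):ℝ)^j := hj.le.trans h1
      calc D2 * ((n+2:ℕ):ℝ)^3 ≤ ((n+2:ℕ):ℝ)^j * ((n+2:ℕ):ℝ)^3 :=
            mul_le_mul_of_nonneg_right h2 (by positivity)
        _ = _ := by ring
    have hX := (hB n u hu).trans (ENNReal.ofReal_le_ofReal
      (mul_le_mul_of_nonneg_right key (exp_pos (-c2 * u)).le))
    have := num_comb (c := min (c1 / 3) (c2 / (3 + j))) (C := 1) (j+2) (h.piN_le_one n _)
      zero_le_one hX hcpos.le ?_ le_rfl le_rfl hu.le hN1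
    · rwa [one_mul] at this
    · have h3 := min_le_right (c1 / 3) (c2 / (3 + j))
      rw [le_div_iff₀ hj3] at h3
      push_cast
      linarith


end
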